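/- Let V: ℝⁿ → ℝ be locally Lipschitz and let φ: (a, b) → ℝⁿ be differentiable at a point t ∈ (a, b). Then the upper right Dini derivative of V ∘ φ at t is bounded by the Clarke derivative: limsup_{h → 0⁺} (V(φ(t + h)) − V(φ(t)))/h ≤ V°(φ(t); φ′(t)). In particular, if V ∘ φ is differentiable at t, then (V ∘ φ)′(t) ≤ V°(φ(t); φ′(t)). -/

import Mathlib

open Filter Set

/-- The Clarke generalized directional derivative of `V` at `x` in direction `v`:
`V°(x; v) := limsup_{h → 0⁺, y → x} (V(y + h·v) − V(y))/h`. -/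
noncomputable def clarkeDeriv {n : ℕ} (V : EuclideanSpace ℝ (Fin n) → ℝ)
    (x v : EuclideanSpace ℝ (Fin n)) : ℝ :=
  Filter.limsup (fun p : ℝ × EuclideanSpace ℝ (Fin n) => (V (p.2 + p.1 • v) - V p.2) / p.1)
    ((nhdsWithin (0 : ℝ) (Set.Ioi 0)) ×ˢ (nhds x))

open scoped Topology

section

variable {E : Type*} [NormedAddCommGroup E] [NormedSpace ℝ E]

theorem tendsto_snd_add_fst_smul (x v : E) :
    Tendsto (fun p : ℝ × E => p.2 + p.1 • v) (𝓝[>] (0 : ℝ) ×ˢ 𝓝 x) (𝓝 x) := by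
  have hc : Continuous fun p : ℝ × E => p.2 + p.1 • v := by fun_prop
  have h := hc.tendsto ((0 : ℝ), x)
  rw [nhds_prod_eq] at h
  simpa using h.mono_left (Filter.prod_mono nhdsWithin_le_nhds le_rfl)

theorem LocallyLipschitz.exists_eventually_abs_quotient_le {V : E → ℝ} (hV : LocallyLipschitz V)
    (x v : E) :
    ∃ C : ℝ, ∀ᶠ p in 𝓝[>] (0 : ℝ) ×ˢ 𝓝 x, |(V (p.2 + p.1 • v) - V p.2) / p.1| ≤ C := by
  obtain ⟨K, s, hs, hK⟩ := hV x
  refine ⟨K * ‖v‖, ?_⟩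
  have hpos : ∀ᶠ p : ℝ × E in 𝓝[>] (0 : ℝ) ×ˢ 𝓝 x, 0 < p.1 :=
    tendsto_fst.eventually eventually_mem_nhdsWithin
  filter_upwards [hpos, tendsto_snd_add_fst_smul x v hs, tendsto_snd hs] with p hp h₁ h₂
  rw [abs_div, abs_of_pos hp, div_le_iff₀ hp]
  have h := hK.dist_le_mul _ h₁ _ h₂
  rw [Real.dist_eq, dist_eq_norm, add_sub_cancel_left, norm_smul, Real.norm_of_nonneg hp.le] at h
  linarith

theorem LocallyLipschitz.tendsto_quotient_comp_sub_quotient {V : E → ℝ} (hV : LocallyLipschitz V)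
    {φ : ℝ → E} {t : ℝ} {v : E} (hφ : HasDerivAt φ v t) :
    Tendsto (fun h : ℝ => (V (φ (t + h)) - V (φ t)) / h - (V (φ t + h • v) - V (φ t)) / h)
      (𝓝[>] 0) (𝓝 0) := by
  obtain ⟨K, s, hs, hK⟩ := hV (φ t)
  have hcurve : Tendsto (fun h : ℝ => φ (t + h)) (𝓝[>] 0) (𝓝 (φ t)) := by
    have hadd : Tendsto (fun h : ℝ => t + h) (𝓝[>] 0) (𝓝 t) := by
      simpa using ((continuous_const_add t).tendsto 0).mono_left nhdsWithin_le_nhds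
    exact hφ.continuousAt.tendsto.comp hadd
  have hline : Tendsto (fun h : ℝ => φ t + h • v) (𝓝[>] 0) (𝓝 (φ t)) :=
    (tendsto_snd_add_fst_smul (φ t) v).comp (tendsto_id.prodMk tendsto_const_nhds)
  have hbound : Tendsto (fun h : ℝ => K * ‖h⁻¹ • (φ (t + h) - φ t) - v‖) (𝓝[>] 0) (𝓝 0) := by
    simpa using ((hφ.tendsto_slope_zero_right.sub_const v).norm).const_mul (K : ℝ)
  refine squeeze_zero_norm' ?_ hbound
  filter_upwards [eventually_mem_nhdsWithin, hcurve hs, hline hs] with h hh h₁ h₂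
  have hpos : 0 < h := hh
  have hvec : φ (t + h) - (φ t + h • v) = h • (h⁻¹ • (φ (t + h) - φ t) - v) := by
    rw [smul_sub, smul_inv_smul₀ hpos.ne', sub_sub]
  have hle := hK.dist_le_mul _ h₁ _ h₂
  rw [Real.dist_eq, dist_eq_norm, hvec, norm_smul, Real.norm_of_nonneg hpos.le] at hle
  rw [← sub_div, sub_sub_sub_cancel_right, Real.norm_eq_abs, abs_div, abs_of_pos hpos,
    div_le_iff₀ hpos]
  linarith

end

theorem LocallyLipschitz.limsup_quotient_comp_le_clarkeDeriv {n : ℕ}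
    {V : EuclideanSpace ℝ (Fin n) → ℝ} (hV : LocallyLipschitz V)
    {φ : ℝ → EuclideanSpace ℝ (Fin n)} {t : ℝ} {v : EuclideanSpace ℝ (Fin n)}
    (hφ : HasDerivAt φ v t) :
    limsup (fun h : ℝ => (V (φ (t + h)) - V (φ t)) / h) (𝓝[>] 0) ≤ clarkeDeriv V (φ t) v := by
  obtain ⟨C, hC⟩ := hV.exists_eventually_abs_quotient_le (φ t) v
  have hline : Tendsto (fun h : ℝ => (h, φ t)) (𝓝[>] 0) (𝓝[>] (0 : ℝ) ×ˢ 𝓝 (φ t)) :=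
    tendsto_id.prodMk tendsto_const_nhds
  have hdiff := hV.tendsto_quotient_comp_sub_quotient hφ
  have hcobdd : IsCoboundedUnder (· ≤ ·) (𝓝[>] (0 : ℝ))
      (fun h : ℝ => (V (φ (t + h)) - V (φ t)) / h) := by
    refine IsBoundedUnder.isCoboundedUnder_le (isBoundedUnder_of_eventually_ge (a := -C - 1) ?_)
    filter_upwards [hline.eventually hC, hdiff.eventually_const_lt neg_one_lt_zero] with h h₁ h₂
    linarith [(abs_le.mp h₁).1]
  refine le_of_forall_pos_le_add fun ε hε => limsup_le_of_le hcobdd ?_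
  have hbdd : IsBoundedUnder (· ≤ ·) (𝓝[>] (0 : ℝ) ×ˢ 𝓝 (φ t))
      (fun p => (V (p.2 + p.1 • v) - V p.2) / p.1) :=
    isBoundedUnder_of_eventually_le (hC.mono fun _ h => (abs_le.mp h).2)
  have hlt := eventually_lt_of_limsup_lt (b := clarkeDeriv V (φ t) v + ε / 2)
    (lt_add_of_pos_right (clarkeDeriv V (φ t) v) (half_pos hε)) hbdd
  filter_upwards [hline.eventually hlt, hdiff.eventually_lt_const (half_pos hε)] with h h₁ h₂
  linarith

/-- For a locally Lipschitz `V : ℝⁿ → ℝ` and a curve `φ` differentiable at `t ∈ (a, b)`,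
the upper right Dini derivative of `V ∘ φ` at `t` is bounded by the Clarke derivative
`V°(φ(t); φ'(t))`; in particular, if `V ∘ φ` is differentiable at `t`, then
`(V ∘ φ)'(t) ≤ V°(φ(t); φ'(t))`. -/
theorem diniDeriv_comp_le_clarkeDeriv {n : ℕ} (V : EuclideanSpace ℝ (Fin n) → ℝ)
    (hV : LocallyLipschitz V) (φ : ℝ → EuclideanSpace ℝ (Fin n)) (a b t : ℝ)
    (ht : t ∈ Set.Ioo a b) (hφ : DifferentiableAt ℝ φ t) :
    Filter.limsup (fun h : ℝ => (V (φ (t + h)) - V (φ t)) / h)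
        (nhdsWithin (0 : ℝ) (Set.Ioi 0)) ≤ clarkeDeriv V (φ t) (deriv φ t) ∧
      (DifferentiableAt ℝ (V ∘ φ) t → deriv (V ∘ φ) t ≤ clarkeDeriv V (φ t) (deriv φ t)) := by
  have hle := hV.limsup_quotient_comp_le_clarkeDeriv hφ.hasDerivAt
  refine ⟨hle, fun hd => ?_⟩
  have hlim : Tendsto (fun h : ℝ => (V (φ (t + h)) - V (φ t)) / h) (𝓝[>] 0)
      (𝓝 (deriv (V ∘ φ) t)) := by
    simpa [div_eq_inv_mul] using hd.hasDerivAt.tendsto_slope_zero_right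
  exact hlim.limsup_eq ▸ hle
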